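/- Let a(n) = \sum_{k=0}^{n} \binom{n}{k}^2 \binom{n+k}{k}^2, and let b : \mathbb{N} \to \mathbb{Q} be the unique sequence with b(0) = 0, b(1) = 1 and n^3 b(n) - (34 n^3 - 51 n^2 + 27 n - 5) b(n-1) + (n-1)^3 b(n-2) = 0 for all n \ge 2. Then the sequence of ratios b(n)/a(n) converges, and \lim_{n \to \infty} b(n)/a(n) = \zeta(3)/6. -/

import Mathlib

open Filter

/-- `u n k = (n choose k) * (n+k choose k)`. -/
def apU (n k : ℕ) : ℚ := (n.choose k : ℚ) * ((n + k).choose k : ℚ)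

/-- Apéry's `c n k`. -/
def apC (n k : ℕ) : ℚ :=
  (∑ m ∈ Finset.range n, 1 / ((m : ℚ) + 1) ^ 3) +
    ∑ m ∈ Finset.range k, (-1) ^ m / (2 * ((m : ℚ) + 1) ^ 3 * apU n (m + 1))

lemma apU_pos {n k : ℕ} (h : k ≤ n) : 0 < apU n k := by
  unfold apU
  have h1 := Nat.choose_pos h
  have h2 : 0 < (n + k).choose k := Nat.choose_pos (by omega)
  positivity

lemma apU_zero_of_lt {n k : ℕ} (h : n < k) : apU n k = 0 := by
  unfold apU
  rw [Nat.choose_eq_zero_of_lt h]; simp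

lemma apU_n (n k : ℕ) : ((n : ℚ) + 1 - k) * apU (n + 1) k = (n + 1 + k) * apU n k := by
  rcases Nat.lt_or_ge (n + 1) k with h | h
  · rw [apU_zero_of_lt h, apU_zero_of_lt (by omega)]; simp
  · have h1 := Nat.choose_mul_succ_eq n k
    have h2 := Nat.choose_mul_succ_eq (n + k) k
    have e : n + k + 1 - k = n + 1 := by omega
    rw [e] at h2
    have h1' : (n.choose k : ℚ) * (n + 1) = (n + 1).choose k * ((n : ℚ) + 1 - k) := by
      have := congrArg (Nat.cast (R := ℚ)) h1
      push_cast [Nat.cast_sub h] at this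
      exact this
    have h2' : ((n + k).choose k : ℚ) * (n + k + 1) = (n + k + 1).choose k * ((n : ℚ) + 1) := by
      exact_mod_cast h2
    unfold apU
    have e2 : n + 1 + k = n + k + 1 := by ring
    rw [e2]
    have hn : (n : ℚ) + 1 ≠ 0 := by positivity
    apply mul_left_cancel₀ hn
    linear_combination (-(n : ℚ) - 1) * ((n + k + 1).choose k : ℚ) * h1' - (n + 1) * (n.choose k : ℚ) * h2'

lemma apU_k (n k : ℕ) :
    ((k : ℚ) + 1) ^ 2 * apU n (k + 1) = (n + k + 1) * (n - k) * apU n k := by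
  rcases Nat.lt_or_ge n k with h | h
  · rw [apU_zero_of_lt h, apU_zero_of_lt (by omega)]; simp
  · have h1 := Nat.choose_succ_right_eq n k
    have h2 := Nat.add_one_mul_choose_eq (n + k) k
    have h1' : (n.choose (k + 1) : ℚ) * (k + 1) = n.choose k * ((n : ℚ) - k) := by
      have := congrArg (Nat.cast (R := ℚ)) h1
      push_cast [Nat.cast_sub h] at this
      exact this
    have h2' : ((n : ℚ) + k + 1) * (n + k).choose k = (n + k + 1).choose (k + 1) * ((k : ℚ) + 1) := by
      exact_mod_cast h2
    unfold apU
    rw [← add_assoc]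
    linear_combination ((k : ℚ) + 1) * ((n + k + 1).choose (k + 1) : ℚ) * h1' -
      (n - k) * (n.choose k : ℚ) * h2'

lemma apC_succ (n k : ℕ) :
    apC n (k + 1) = apC n k + (-1) ^ k / (2 * ((k : ℚ) + 1) ^ 3 * apU n (k + 1)) := by
  unfold apC
  rw [Finset.sum_range_succ _ k]; ring

lemma apC_diff (n k : ℕ) (h : k ≤ n) :
    apC (n + 1) k - apC n k = (-1) ^ k / (((n : ℚ) + 1) ^ 2 * (n + 1 + k) * apU n k) := by
  induction k with
  | zero =>
    unfold apC apU
    rw [Finset.sum_range_succ]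
    simp
    field_simp
  | succ k ih =>
    have ih := ih (by omega)
    obtain ⟨j, rfl⟩ := Nat.exists_eq_add_of_le h
    rw [apC_succ, apC_succ]
    have e1 := apU_n (k + 1 + j) (k + 1)
    have e2 := apU_k (k + 1 + j) k
    have p0 := apU_pos (n := k + 1 + j) (k := k) (by omega)
    push_cast at *
    have e2' : apU (k + 1 + j) (k + 1) =
        ((k + 1 + j : ℚ) + k + 1) * (j + 1) / (k + 1) ^ 2 * apU (k + 1 + j) k := by
      field_simp
      linear_combination e2
    have e1' : apU (k + 1 + j + 1) (k + 1) =
        ((k + 1 + j : ℚ) + 1 + (k + 1)) / (j + 1) * apU (k + 1 + j) (k + 1) := by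
      field_simp
      linear_combination e1
    rw [e1', e2']
    have ih' : apC (k + 1 + j + 1) k = apC (k + 1 + j) k +
      (-1) ^ k / (((k : ℚ) + 1 + j + 1) ^ 2 * (k + 1 + j + 1 + k) * apU (k + 1 + j) k) := by
      linear_combination ih
    rw [ih', pow_succ (-1 : ℚ) k]
    have s : ((-1 : ℚ)) ^ k ≠ 0 := by positivity
    generalize (-1 : ℚ) ^ k = s at *
    generalize apU (k + 1 + j) k = v at *
    have := p0.ne'
    field_simp
    ring

/-- The summand of the recurrence for the numerators, with `N = n+1` in the middle. -/
def apT (n k : ℕ) : ℚ :=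
  ((n : ℚ) + 2) ^ 3 * (apU (n + 2) k ^ 2 * apC (n + 2) k)
    - (34 * ((n : ℚ) + 2) ^ 3 - 51 * ((n : ℚ) + 2) ^ 2 + 27 * ((n : ℚ) + 2) - 5) *
        (apU (n + 1) k ^ 2 * apC (n + 1) k)
    + ((n : ℚ) + 1) ^ 3 * (apU n k ^ 2 * apC n k)

def apA (n k : ℕ) : ℚ :=
  4 * (2 * (n : ℚ) + 3) * (k * (2 * k + 1) - (2 * (n : ℚ) + 3) ^ 2) *
      apU (n + 1) k ^ 2 * apC (n + 1) k
    - 5 * (2 * (n : ℚ) + 3) * (-1) ^ k * k / ((n + 1) * (n + 2)) * apU (n + 1) k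

lemma apT_zero (n : ℕ) : apT n 0 = apA n 0 := by
  have h1 := apC_diff n 0 (by omega)
  have h2 := apC_diff (n + 1) 0 (by omega)
  have u : ∀ m, apU m 0 = 1 := by intro m; simp [apU]
  unfold apT apA
  simp only [u] at *
  have h1' : apC n 0 = apC (n + 1) 0 - 1 / (((n : ℚ) + 1) ^ 3) := by
    rw [eq_sub_iff_add_eq, ← eq_sub_iff_add_eq', h1]; push_cast; field_simp; simp
  have h2' : apC (n + 2) 0 = apC (n + 1) 0 + 1 / (((n : ℚ) + 2) ^ 3) := by
    rw [← sub_eq_iff_eq_add', show n + 2 = n + 1 + 1 from rfl, h2]; push_cast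
    rw [show (n : ℚ) + 1 + 1 = n + 2 by ring]; field_simp; simp
  rw [h1', h2']
  push_cast
  field_simp
  ring

lemma apT_succ (n k : ℕ) (h : k ≤ n) : apT n (k + 1) = apA n (k + 1) - apA n k := by
  obtain ⟨j, rfl⟩ := Nat.exists_eq_add_of_le h
  have p0 := apU_pos (n := k + j + 1) (k := k) (by omega)
  have p1 := apU_pos (n := k + j + 1) (k := k + 1) (by omega)
  have d2 := apC_diff (k + j + 1) (k + 1) (by omega)
  have e1 := apU_n (k + j) (k + 1)
  have e2 := apU_n (k + j + 1) (k + 1)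
  have e3 := apU_k (k + j + 1) k
  have d1 : apU (k + j) (k + 1) ^ 2 * apC (k + j) (k + 1) =
      apU (k + j) (k + 1) ^ 2 * apC (k + j + 1) (k + 1) +
      apU (k + j) (k + 1) * ((-1) ^ k / (((k : ℚ) + j + 1) ^ 2 * (k + j + 1 + (k + 1)))) := by
    rcases Nat.eq_zero_or_pos j with rfl | hj
    · rw [apU_zero_of_lt (by omega)]; simp
    · have d := apC_diff (k + j) (k + 1) (by omega)
      have p := apU_pos (n := k + j) (k := k + 1) (by omega)
      have d' : apC (k + j) (k + 1) = apC (k + j + 1) (k + 1) -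
        (-1) ^ (k + 1) / (((k : ℚ) + j + 1) ^ 2 * (k + j + 1 + (k + 1)) * apU (k + j) (k + 1)) := by
        push_cast at d
        linear_combination -d
      rw [d', pow_succ (-1 : ℚ) k]
      have := p.ne'
      field_simp
      ring
  have c0 := apC_succ (k + j + 1) k
  unfold apT apA
  rw [d1]
  rw [show k + j + 2 = k + j + 1 + 1 from rfl]
  push_cast at *
  have d2' : apC (k + j + 1 + 1) (k + 1) = apC (k + j + 1) (k + 1) +
     (-1) ^ (k + 1) / (((k : ℚ) + j + 1 + 1) ^ 2 * (k + j + 1 + 1 + (k + 1)) * apU (k + j + 1) (k + 1)) := by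
    linear_combination d2
  have c0' : apC (k + j + 1) k = apC (k + j + 1) (k + 1) -
      (-1) ^ k / (2 * ((k : ℚ) + 1) ^ 3 * apU (k + j + 1) (k + 1)) := by
    linear_combination -c0
  have e3' : apU (k + j + 1) (k + 1) =
      ((k : ℚ) + j + 1 + k + 1) * (j + 1) / (k + 1) ^ 2 * apU (k + j + 1) k := by
    field_simp
    linear_combination e3
  have e2' : apU (k + j + 1 + 1) (k + 1) =
      ((k : ℚ) + j + 1 + 1 + (k + 1)) / (j + 1) * apU (k + j + 1) (k + 1) := by
    field_simp
    linear_combination e2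
  have e1' : apU (k + j) (k + 1) =
      (j : ℚ) / (k + j + 1 + (k + 1)) * apU (k + j + 1) (k + 1) := by
    field_simp
    linear_combination -e1
  rw [d2', c0', e1', e2', e3', pow_succ (-1 : ℚ) k]
  have s : ((-1 : ℚ)) ^ k ≠ 0 := by positivity
  generalize (-1 : ℚ) ^ k = s at *
  generalize apU (k + j + 1) k = v at *
  generalize apC (k + j + 1) (k + 1) = c at *
  have := p0.ne'
  clear * - this
  field_simp
  ring

lemma apT_last (n : ℕ) : apT n (n + 2) = - apA n (n + 1) := by
  have p1 := apU_pos (n := n + 1) (k := n + 1) (by omega)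
  have d2 := apC_diff (n + 1) (n + 1) (by omega)
  have c0 := apC_succ (n + 2) (n + 1)
  have e2 := apU_n (n + 1) (n + 1)
  have e3 := apU_k (n + 2) (n + 1)
  unfold apT apA
  rw [apU_zero_of_lt (show n < n + 2 by omega), apU_zero_of_lt (show n + 1 < n + 2 by omega)]
  simp only [show n + 1 + 1 = n + 2 from rfl] at *
  push_cast at *
  have d2' : apC (n + 2) (n + 1) = apC (n + 1) (n + 1) +
     (-1) ^ (n + 1) / (((n : ℚ) + 1 + 1) ^ 2 * (n + 1 + 1 + (n + 1)) * apU (n + 1) (n + 1)) := by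
    linear_combination d2
  have e2' : apU (n + 2) (n + 1) = (2 * n + 3 : ℚ) * apU (n + 1) (n + 1) := by
    linear_combination e2
  have e3' : apU (n + 2) (n + 2) = (2 * n + 4 : ℚ) / (n + 2) ^ 2 * apU (n + 2) (n + 1) := by
    field_simp
    linear_combination e3
  rw [c0, d2', e3', e2', pow_succ (-1 : ℚ) n]
  generalize (-1 : ℚ) ^ n = s at *
  generalize apU (n + 1) (n + 1) = v at *
  generalize apC (n + 1) (n + 1) = c at *
  have := p1.ne'
  clear * - this
  field_simp
  ring

lemma apT_sum (n : ℕ) : ∑ k ∈ Finset.range (n + 3), apT n k = 0 := by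
  have key : ∀ K, K ≤ n + 1 → ∑ k ∈ Finset.range (K + 1), apT n k = apA n K := by
    intro K
    induction K with
    | zero => intro _; simp [apT_zero]
    | succ K ih =>
      intro h
      rw [Finset.sum_range_succ, ih (by omega), apT_succ n K (by omega)]; ring
  rw [Finset.sum_range_succ, key (n + 1) le_rfl, apT_last]; ring

/-- Apéry's numerators. -/
def apB (n : ℕ) : ℚ := ∑ k ∈ Finset.range (n + 1), apU n k ^ 2 * apC n k

lemma apB_eq (n M : ℕ) (h : n + 1 ≤ M) :
    apB n = ∑ k ∈ Finset.range M, apU n k ^ 2 * apC n k := by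
  unfold apB
  apply Finset.sum_subset (by simpa using h)
  intro x _ hx
  rw [apU_zero_of_lt (by simpa using hx)]; simp

lemma apB_rec (n : ℕ) :
  ((n : ℚ) + 2) ^ 3 * apB (n + 2)
    - (34 * ((n : ℚ) + 2) ^ 3 - 51 * ((n : ℚ) + 2) ^ 2 + 27 * ((n : ℚ) + 2) - 5) * apB (n + 1)
    + ((n : ℚ) + 1) ^ 3 * apB n = 0 := by
  rw [← apT_sum n, apB_eq n (n + 3) (by omega), apB_eq (n + 1) (n + 3) (by omega),
    apB_eq (n + 2) (n + 3) (by omega)]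
  unfold apT
  rw [Finset.sum_add_distrib, Finset.sum_sub_distrib, Finset.mul_sum, Finset.mul_sum,
    Finset.mul_sum]

lemma apU_ge {n m : ℕ} (h : m + 1 ≤ n) : (n : ℚ) ≤ apU n (m + 1) := by
  have h1 : 1 ≤ n.choose (m + 1) := Nat.choose_pos h
  have h2 : n ≤ (n + (m + 1)).choose (m + 1) := by
    have e : (n + (m + 1)).choose (m + 1) = (n + (m + 1)).choose n := by
      rw [Nat.choose_symm_add]
    have e1 : (n + 1).choose n ≤ (n + (m + 1)).choose n := Nat.choose_le_choose n (by omega)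
    rw [e]
    simp at e1
    omega
  unfold apU
  have := Nat.mul_le_mul h1 h2
  rw [one_mul] at this
  exact_mod_cast this

lemma sum_cubes_le (n : ℕ) :
    ∑ m ∈ Finset.range n, 1 / ((m : ℚ) + 1) ^ 3 ≤ 2 - 2 / ((n : ℚ) + 1) := by
  induction n with
  | zero => norm_num
  | succ n ih =>
    rw [Finset.sum_range_succ]
    have : 1 / ((n : ℚ) + 1) ^ 3 ≤ 2 / ((n : ℚ) + 1) - 2 / ((n : ℚ) + 1 + 1) := by
      rw [div_sub_div _ _ (by positivity) (by positivity), div_le_div_iff₀ (by positivity) (by positivity)]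
      have : (0 : ℚ) ≤ n := by positivity
      nlinarith [mul_nonneg this this, mul_nonneg this (mul_nonneg this this)]
    push_cast
    linarith

lemma apC_close (n k : ℕ) (hn : 1 ≤ n) (h : k ≤ n) :
    |apC n k - ∑ m ∈ Finset.range n, 1 / ((m : ℚ) + 1) ^ 3| ≤ 1 / n := by
  unfold apC
  rw [add_sub_cancel_left]
  have hn' : (0 : ℚ) < n := by exact_mod_cast hn
  calc _ ≤ ∑ m ∈ Finset.range k, |(-1) ^ m / (2 * ((m : ℚ) + 1) ^ 3 * apU n (m + 1))| :=
        Finset.abs_sum_le_sum_abs _ _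
    _ ≤ ∑ m ∈ Finset.range k, 1 / (2 * n) * (1 / ((m : ℚ) + 1) ^ 3) := by
        apply Finset.sum_le_sum
        intro m hm
        have hm' : m + 1 ≤ n := by have := Finset.mem_range.1 hm; omega
        have g := apU_ge hm'
        have p := apU_pos hm'
        rw [abs_div, abs_pow, abs_neg, abs_one, one_pow, abs_of_pos (by positivity),
          div_mul_div_comm, one_mul]
        apply one_div_le_one_div_of_le (by positivity)
        have : 0 < ((m : ℚ) + 1) ^ 3 := by positivity
        nlinarith
    _ = 1 / (2 * n) * ∑ m ∈ Finset.range k, (1 / ((m : ℚ) + 1) ^ 3) := by rw [Finset.mul_sum]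
    _ ≤ 1 / (2 * n) * 2 := by
        have := sum_cubes_le k
        have : 0 ≤ 2 / ((k : ℚ) + 1) := by positivity
        apply mul_le_mul_of_nonneg_left (by linarith) (by positivity)
    _ = 1 / n := by field_simp

/-- Apéry's theorem for ζ(3): with `a n = ∑_k (n choose k)² ((n+k) choose k)²` and `b` the
solution of the same recursion with initial values `b 0 = 0`, `b 1 = 1`, the ratios
`b n / a n` converge to `ζ(3)/6`. -/
theorem apery_limit_zeta3
    (a b : ℕ → ℚ)
    (ha : ∀ n : ℕ, a n = ∑ k ∈ Finset.range (n + 1),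
      ((n.choose k : ℚ)) ^ 2 * (((n + k).choose k : ℚ)) ^ 2)
    (hb0 : b 0 = 0) (hb1 : b 1 = 1)
    (hb : ∀ n : ℕ, 2 ≤ n →
      (n : ℚ) ^ 3 * b n
        - (34 * (n : ℚ) ^ 3 - 51 * (n : ℚ) ^ 2 + 27 * (n : ℚ) - 5) * b (n - 1)
        + ((n : ℚ) - 1) ^ 3 * b (n - 2) = 0) :
    Tendsto (fun n : ℕ => ((b n : ℝ) / (a n : ℝ))) atTop
      (nhds ((∑' m : ℕ, 1 / ((m : ℝ) + 1) ^ 3) / 6)) := by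
  have hau : ∀ n, a n = ∑ k ∈ Finset.range (n + 1), apU n k ^ 2 := by
    intro n; rw [ha]; simp only [apU, mul_pow]
  have hapos : ∀ n, 0 < a n := by
    intro n
    rw [hau]
    apply Finset.sum_pos
    · intro k hk
      have := apU_pos (n := n) (k := k) (by have := Finset.mem_range.1 hk; omega)
      positivity
    · simp
  have hbB : ∀ n, b n = apB n / 6 ∧ b (n + 1) = apB (n + 1) / 6 := by
    intro n
    induction n with
    | zero =>
      rw [hb0, zero_add, hb1]
      constructor <;> norm_num [apB, apC, apU, Finset.sum_range_succ]
    | succ n ih =>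
      refine ⟨ih.2, ?_⟩
      have h := hb (n + 2) (by omega)
      have h' := apB_rec n
      simp only [show n + 2 - 1 = n + 1 from rfl, show n + 2 - 2 = n from rfl, ih.1, ih.2] at h
      push_cast at h
      have p : ((n : ℚ) + 2) ^ 3 ≠ 0 := by positivity
      apply mul_left_cancel₀ p
      linear_combination h - h' / 6
  have hclose : ∀ n, 1 ≤ n →
      |b n / a n - (∑ m ∈ Finset.range n, 1 / ((m : ℚ) + 1) ^ 3) / 6| ≤ 1 / n := by
    intro n hn
    set H := ∑ m ∈ Finset.range n, 1 / ((m : ℚ) + 1) ^ 3 with hH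
    have e : b n / a n - H / 6 =
        (∑ k ∈ Finset.range (n + 1), apU n k ^ 2 * (apC n k - H)) / (6 * a n) := by
      have : ∑ k ∈ Finset.range (n + 1), apU n k ^ 2 * (apC n k - H) = apB n - a n * H := by
        rw [hau, apB, Finset.sum_mul, ← Finset.sum_sub_distrib]
        simp only [mul_sub]
      rw [this, (hbB n).1]
      have := (hapos n).ne'
      field_simp
    have hn' : (0 : ℚ) < n := by exact_mod_cast hn
    have hs : |∑ k ∈ Finset.range (n + 1), apU n k ^ 2 * (apC n k - H)| ≤ a n * (1 / n) := by
      rw [hau, Finset.sum_mul]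
      refine (Finset.abs_sum_le_sum_abs _ _).trans (Finset.sum_le_sum ?_)
      intro k hk
      rw [abs_mul, abs_of_nonneg (sq_nonneg _)]
      exact mul_le_mul_of_nonneg_left
        (apC_close n k hn (by have := Finset.mem_range.1 hk; omega)) (sq_nonneg _)
    have pa := hapos n
    rw [e, abs_div, abs_of_pos (show 0 < 6 * a n by positivity), div_le_iff₀ (by positivity)]
    refine hs.trans ?_
    have : 0 < a n * (1 / (n : ℚ)) := by positivity
    nlinarith
  have hsum : Summable (fun m : ℕ => 1 / ((m : ℝ) + 1) ^ 3) := by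
    have := (summable_nat_add_iff 1).2 (Real.summable_one_div_nat_pow.2 (show 1 < 3 by norm_num))
    simpa using this
  have hlim := (hsum.hasSum.tendsto_sum_nat).div_const 6
  have hdiff : Tendsto (fun n : ℕ => ((b n : ℝ) / (a n : ℝ)) -
      (∑ m ∈ Finset.range n, 1 / ((m : ℝ) + 1) ^ 3) / 6) atTop (nhds 0) := by
    apply squeeze_zero_norm' _ (tendsto_one_div_atTop_nhds_zero_nat (𝕜 := ℝ))
    filter_upwards [eventually_ge_atTop 1] with n hn
    have := (Rat.cast_le (K := ℝ)).2 (hclose n hn)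
    rw [Real.norm_eq_abs]
    push_cast at this
    exact this
  simpa using hdiff.add hlim
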